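/- (Late-time asymptotics of ∂ₜη, Theorem 4.1.) Let (η, λ, r, s) be a regular solution on [1,∞). Then there exists a constant C > 0 such that for every t ≥ 1 and every x ∈ ℝ: |∂ₜη(t,x) + 1/t| ≤ C t^{−2}. -/

import Mathlib

open Real Set MeasureTheory

noncomputable section

/-- Partial derivative with respect to the time variable `t`. -/
def pderivT (f : ℝ → ℝ → ℝ) (t x : ℝ) : ℝ := deriv (fun τ => f τ x) t

/-- Partial derivative with respect to the space variable `x`. -/
def pderivX (f : ℝ → ℝ → ℝ) (t x : ℝ) : ℝ := deriv (fun y => f t y) x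

/-- The time interval `[1, T)` for a (possibly infinite) final time `T ∈ (1,∞]`. -/
def timeSlab (T : EReal) : Set ℝ := {t : ℝ | 1 ≤ t ∧ (t : EReal) < T}

/-- A regular solution of the plane-symmetric Einstein–stiff fluid equations in areal
coordinates, with cosmological constant `Λ`, on a time interval `J`:
continuously differentiable functions `η, λ, r, s`, 1-periodic in the space variable,
with `r ≥ 0`, `s ≥ 0`, satisfying the evolution and constraint equations (E1)–(E5). -/
structure RegularSolution (Λ : ℝ) (J : Set ℝ) where
  η : ℝ → ℝ → ℝ
  lam : ℝ → ℝ → ℝ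
  r : ℝ → ℝ → ℝ
  s : ℝ → ℝ → ℝ
  η_c1 : ContDiffOn ℝ 1 (fun p : ℝ × ℝ => η p.1 p.2) (J ×ˢ (Set.univ : Set ℝ))
  lam_c1 : ContDiffOn ℝ 1 (fun p : ℝ × ℝ => lam p.1 p.2) (J ×ˢ (Set.univ : Set ℝ))
  r_c1 : ContDiffOn ℝ 1 (fun p : ℝ × ℝ => r p.1 p.2) (J ×ˢ (Set.univ : Set ℝ))
  s_c1 : ContDiffOn ℝ 1 (fun p : ℝ × ℝ => s p.1 p.2) (J ×ˢ (Set.univ : Set ℝ))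
  η_per : ∀ t ∈ J, ∀ x : ℝ, η t (x + 1) = η t x
  lam_per : ∀ t ∈ J, ∀ x : ℝ, lam t (x + 1) = lam t x
  r_per : ∀ t ∈ J, ∀ x : ℝ, r t (x + 1) = r t x
  s_per : ∀ t ∈ J, ∀ x : ℝ, s t (x + 1) = s t x
  r_nonneg : ∀ t ∈ J, ∀ x : ℝ, 0 ≤ r t x
  s_nonneg : ∀ t ∈ J, ∀ x : ℝ, 0 ≤ s t x
  eqE1 : ∀ t ∈ J, ∀ x : ℝ,
    Real.exp (-2 * η t x) * (2 * t * pderivT lam t x + 1) - Λ * t ^ 2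
      = 4 * Real.pi * t ^ 2 * (r t x + s t x)
  eqE2 : ∀ t ∈ J, ∀ x : ℝ,
    Real.exp (-2 * η t x) * (2 * t * pderivT η t x - 1) + Λ * t ^ 2
      = 4 * Real.pi * t ^ 2 * (r t x + s t x)
  eqE3 : ∀ t ∈ J, ∀ x : ℝ,
    pderivX η t x = -(2 * Real.pi * t * Real.exp (lam t x + η t x) * (r t x - s t x))
  eqE4 : ∀ t ∈ J, ∀ x : ℝ,
    pderivT r t x + Real.exp (η t x - lam t x) * pderivX r t x
      = -2 * (pderivT lam t x + Real.exp (η t x - lam t x) * pderivX η t x + 1 / t) * r t x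
        - 2 / t * Real.sqrt (r t x * s t x)
  eqE5 : ∀ t ∈ J, ∀ x : ℝ,
    pderivT s t x - Real.exp (η t x - lam t x) * pderivX s t x
      = -2 * (pderivT lam t x - Real.exp (η t x - lam t x) * pderivX η t x + 1 / t) * s t x
        - 2 / t * Real.sqrt (r t x * s t x)

/-- A 1-periodic function takes the same value at `x` and at its fractional part. -/
lemma periodic_apply_fract {f : ℝ → ℝ} (hf : ∀ x, f (x + 1) = f x) (x : ℝ) :
    f (Int.fract x) = f x := by
  have hp : Function.Periodic f 1 := hf
  have h := hp.sub_zsmul_eq (x := x) ⌊x⌋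
  rwa [zsmul_eq_mul, mul_one] at h

/-- A continuous spatially periodic function on a compact time interval attains its maximum. -/
lemma exists_forall_le_of_periodic {f : ℝ → ℝ → ℝ} {T : ℝ} (hT : 1 ≤ T)
    (hc : ContinuousOn (fun p : ℝ × ℝ => f p.1 p.2) (Ici 1 ×ˢ univ))
    (hper : ∀ t ∈ Ici (1 : ℝ), ∀ x, f t (x + 1) = f t x) :
    ∃ t₀ ∈ Icc 1 T, ∃ x₀, ∀ t ∈ Icc 1 T, ∀ x, f t x ≤ f t₀ x₀ := by
  have hK : IsCompact (Icc (1 : ℝ) T ×ˢ Icc (0 : ℝ) 1) := isCompact_Icc.prod isCompact_Icc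
  obtain ⟨p, hp, hmax⟩ := hK.exists_isMaxOn ⟨(1, 0), by simp [hT]⟩
    (hc.mono (prod_mono Icc_subset_Ici_self (subset_univ _)))
  refine ⟨p.1, hp.1, p.2, fun t ht x => ?_⟩
  rw [← periodic_apply_fract (hper t ht.1) x]
  exact hmax (show (t, Int.fract x) ∈ _ from
    ⟨ht, (Int.fract_nonneg x), (Int.fract_lt_one x).le⟩)

/-- A derivative at the right endpoint of an interval on which the function is maximal there
is nonnegative. -/
lemma HasDerivAt.nonneg_of_forall_le_left {g : ℝ → ℝ} {g' a b : ℝ} (hab : a < b)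
    (hg : HasDerivAt g g' b) (hmax : ∀ t ∈ Icc a b, g t ≤ g b) : 0 ≤ g' := by
  have h := (hasDerivAt_iff_tendsto_slope.1 hg).mono_left
    (nhdsWithin_mono b (fun t (ht : t < b) => ht.ne))
  refine ge_of_tendsto (x := nhdsWithin b (Iio b)) h ?_
  filter_upwards [Ioo_mem_nhdsLT hab] with t ht
  rw [slope_def_field]
  exact div_nonneg_of_nonpos (by linarith [hmax t ⟨ht.1.le, ht.2.le⟩]) (by linarith [ht.2])

/-- Time slices of a `C¹` function on `[1,∞) × ℝ` are differentiable at interior times. -/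
lemma hasDerivAt_pderivT {f : ℝ → ℝ → ℝ}
    (hf : ContDiffOn ℝ 1 (fun p : ℝ × ℝ => f p.1 p.2) (Ici 1 ×ˢ univ)) {t : ℝ} (ht : 1 < t)
    (x : ℝ) : HasDerivAt (fun τ => f τ x) (pderivT f t x) t := by
  have hn : (Ici 1 ×ˢ univ : Set (ℝ × ℝ)) ∈ nhds (t, x) :=
    prod_mem_nhds (Ici_mem_nhds ht) Filter.univ_mem
  have hd : DifferentiableAt ℝ (fun p : ℝ × ℝ => f p.1 p.2) (t, x) :=
    (hf.contDiffAt hn).differentiableAt (by norm_num)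
  have hg : DifferentiableAt ℝ (fun τ : ℝ => (τ, x)) t := by fun_prop
  exact (hd.comp (f := fun τ : ℝ => (τ, x)) t hg).hasDerivAt

/-- Maximum principle: if `∂ₜ(t f) ≤ 0` wherever `∂ₓf` vanishes, then `t f` is bounded above. -/
lemma exists_mul_le_of_critical {f : ℝ → ℝ → ℝ}
    (hf : ContDiffOn ℝ 1 (fun p : ℝ × ℝ => f p.1 p.2) (Ici 1 ×ˢ univ))
    (hper : ∀ t ∈ Ici (1 : ℝ), ∀ x, f t (x + 1) = f t x)
    (hcrit : ∀ t, 1 < t → ∀ x, pderivX f t x = 0 → f t x + t * pderivT f t x ≤ 0) :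
    ∃ M, ∀ t, 1 ≤ t → ∀ x, t * f t x ≤ M := by
  obtain ⟨t₁, ht₁, x₁, hM⟩ := exists_forall_le_of_periodic le_rfl hf.continuousOn hper
  refine ⟨f t₁ x₁, fun T hT x => ?_⟩
  refine le_of_forall_pos_le_add fun δ hδ => ?_
  set ε := δ / T with hε
  have hεpos : 0 < ε := by positivity
  have hεT : ε * T = δ := by rw [hε]; field_simp
  have hc : ContinuousOn (fun p : ℝ × ℝ => p.1 * f p.1 p.2 - ε * p.1) (Ici 1 ×ˢ univ) :=
    (continuousOn_fst.mul hf.continuousOn).sub (continuousOn_const.mul continuousOn_fst)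
  obtain ⟨t₀, ht₀, x₀, hmax⟩ := exists_forall_le_of_periodic
    (f := fun t x => t * f t x - ε * t) hT hc (fun t ht x => by simp only [hper t ht x])
  have key := hmax T ⟨hT, le_rfl⟩ x
  rcases ht₀.1.eq_or_lt with h1 | h1
  · subst h1
    have := hM 1 ⟨le_rfl, le_rfl⟩ x₀
    linarith
  · exfalso
    have hX : pderivX f t₀ x₀ = 0 := by
      refine IsLocalMax.deriv_eq_zero (Filter.Eventually.of_forall fun y => ?_)
      have := hmax t₀ ht₀ y
      exact le_of_mul_le_mul_left (by linarith : t₀ * f t₀ y ≤ t₀ * f t₀ x₀) (by linarith)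
    have hd : HasDerivAt (fun t => t * f t x₀ - ε * t)
        (1 * f t₀ x₀ + t₀ * pderivT f t₀ x₀ - ε * 1) t₀ :=
      ((hasDerivAt_id t₀).mul (hasDerivAt_pderivT hf h1 x₀)).sub
        ((hasDerivAt_id t₀).const_mul ε)
    have h0 := hd.nonneg_of_forall_le_left h1
      (fun t ht => hmax t ⟨ht.1, ht.2.trans ht₀.2⟩ x₀)
    linarith [hcrit t₀ h1 x₀ hX]

namespace RegularSolution

variable {Λ : ℝ} (sol : RegularSolution Λ (Ici 1))

/-- The constraint equations turn the damping coefficients of (E4) and (E5) into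
manifestly positive quantities. -/
lemma damping_identities {t : ℝ} (ht : 1 ≤ t) (x : ℝ) :
    2 * t * (pderivT sol.lam t x
        + exp (sol.η t x - sol.lam t x) * pderivX sol.η t x + 1 / t)
      = 1 + exp (2 * sol.η t x) * t ^ 2 * (Λ + 8 * π * sol.s t x) ∧
    2 * t * (pderivT sol.lam t x
        - exp (sol.η t x - sol.lam t x) * pderivX sol.η t x + 1 / t)
      = 1 + exp (2 * sol.η t x) * t ^ 2 * (Λ + 8 * π * sol.r t x) := by
  have h1 := sol.eqE1 t ht x
  have h3 := sol.eqE3 t ht x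
  have ht0 : t ≠ 0 := by linarith
  have hee : exp (2 * sol.η t x) * exp (-2 * sol.η t x) = 1 := by
    rw [← exp_add]; simp
  have hem : exp (sol.η t x - sol.lam t x) * exp (sol.lam t x + sol.η t x)
      = exp (2 * sol.η t x) := by rw [← exp_add]; ring_nf
  have hx : exp (sol.η t x - sol.lam t x) * pderivX sol.η t x
      = -(2 * π * t * exp (2 * sol.η t x) * (sol.r t x - sol.s t x)) := by
    rw [h3, ← hem]; ring
  have hl : 2 * t * pderivT sol.lam t x
      = exp (2 * sol.η t x) * (4 * π * t ^ 2 * (sol.r t x + sol.s t x) + Λ * t ^ 2) - 1 := by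
    linear_combination exp (2 * sol.η t x) * h1
      - (2 * t * pderivT sol.lam t x + 1) * hee
  have hti : t * (1 / t) = 1 := by field_simp
  rw [hx]
  constructor <;> linear_combination hl + 2 * hti

/-- The matter densities decay at least like `1 / t`. -/
lemma exists_matter_bound (hΛ : 0 < Λ) :
    ∃ M, 0 ≤ M ∧ ∀ t, 1 ≤ t → ∀ x, t * (sol.r t x + sol.s t x) ≤ M := by
  have aux : ∀ {t a b e d k q : ℝ}, 1 < t → 0 ≤ a → 0 ≤ b → 0 ≤ e → 0 ≤ q →
      2 * t * k = 1 + e * t ^ 2 * (Λ + 8 * π * b) →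
      d = -2 * k * a - 2 / t * q → a + t * d ≤ 0 := by
    intro t a b e d k q ht ha hb he hq hk hd
    have ht0 : t ≠ 0 := by linarith
    have h1 : a + t * d = -(e * t ^ 2 * (Λ + 8 * π * b) * a) - 2 * q := by
      have : t * (2 / t) = 2 := by field_simp
      rw [hd]
      linear_combination (-a) * hk - q * this
    have h2 : 0 ≤ e * t ^ 2 * (Λ + 8 * π * b) * a := by positivity
    linarith
  obtain ⟨M₁, h₁⟩ := exists_mul_le_of_critical sol.r_c1 sol.r_per fun t ht x hX => by
    have h4 := sol.eqE4 t ht.le x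
    rw [hX, mul_zero, add_zero] at h4
    exact aux ht (sol.r_nonneg t ht.le x) (sol.s_nonneg t ht.le x) (exp_pos _).le
      (sqrt_nonneg _) (sol.damping_identities ht.le x).1 h4
  obtain ⟨M₂, h₂⟩ := exists_mul_le_of_critical sol.s_c1 sol.s_per fun t ht x hX => by
    have h5 := sol.eqE5 t ht.le x
    rw [hX, mul_zero, sub_zero] at h5
    exact aux ht (sol.s_nonneg t ht.le x) (sol.r_nonneg t ht.le x) (exp_pos _).le
      (sqrt_nonneg _) (sol.damping_identities ht.le x).2 h5
  have hb : ∀ t, 1 ≤ t → ∀ x, t * (sol.r t x + sol.s t x) ≤ M₁ + M₂ := fun t ht x => by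
    linarith [h₁ t ht x, h₂ t ht x]
  refine ⟨M₁ + M₂, le_trans ?_ (hb 1 le_rfl 0), hb⟩
  have := sol.r_nonneg 1 self_mem_Ici 0
  have := sol.s_nonneg 1 self_mem_Ici 0
  linarith

/-- Integrated form of (E2): `t e^{-2η} - Λ t³ / 3` is nonincreasing and loses at most
`2 π M t²`. -/
lemma exp_neg_two_eta_bounds {M : ℝ}
    (hM : ∀ t, 1 ≤ t → ∀ x, t * (sol.r t x + sol.s t x) ≤ M) {t : ℝ} (ht : 1 ≤ t) (x : ℝ) :
    t * exp (-2 * sol.η t x) - Λ * t ^ 3 / 3 ≤ exp (-2 * sol.η 1 x) - Λ / 3 ∧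
    exp (-2 * sol.η 1 x) - Λ / 3 + 2 * π * M
      ≤ t * exp (-2 * sol.η t x) - Λ * t ^ 3 / 3 + 2 * π * M * t ^ 2 := by
  have hη : ContinuousOn (fun τ => sol.η τ x) (Ici 1) :=
    sol.η_c1.continuousOn.comp (f := fun τ : ℝ => (τ, x)) (by fun_prop)
      (fun τ hτ => ⟨hτ, mem_univ _⟩)
  have hc : ContinuousOn (fun τ => τ * exp (-2 * sol.η τ x) - Λ * τ ^ 3 / 3) (Ici 1) := by
    fun_prop
  have hd : ∀ τ, 1 < τ → HasDerivAt (fun τ => τ * exp (-2 * sol.η τ x) - Λ * τ ^ 3 / 3)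
      (-(4 * π * τ ^ 2 * (sol.r τ x + sol.s τ x))) τ := fun τ hτ => by
    have h := ((hasDerivAt_id τ).mul
      (((hasDerivAt_pderivT sol.η_c1 hτ x).const_mul (-2)).exp)).sub
      (((hasDerivAt_pow 3 τ).const_mul Λ).div_const 3)
    have h2 := sol.eqE2 τ hτ.le x
    refine h.congr_deriv ?_
    simp only [id]
    push_cast
    linear_combination -h2
  have hanti : AntitoneOn (fun τ => τ * exp (-2 * sol.η τ x) - Λ * τ ^ 3 / 3) (Ici 1) := by
    refine antitoneOn_of_hasDerivWithinAt_nonpos (convex_Ici 1) hc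
      (fun τ hτ => (hd τ (by simpa using hτ)).hasDerivWithinAt) fun τ hτ => ?_
    have hτ : 1 < τ := by simpa using hτ
    have := sol.r_nonneg τ hτ.le x
    have := sol.s_nonneg τ hτ.le x
    have : 0 ≤ 4 * π * τ ^ 2 * (sol.r τ x + sol.s τ x) := by positivity
    linarith
  have hmono : MonotoneOn
      (fun τ => τ * exp (-2 * sol.η τ x) - Λ * τ ^ 3 / 3 + 2 * π * M * τ ^ 2) (Ici 1) := by
    refine monotoneOn_of_hasDerivWithinAt_nonneg (convex_Ici 1) (hc.add (by fun_prop))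
      (fun τ hτ => ((hd τ (by simpa using hτ)).add
        ((hasDerivAt_pow 2 τ).const_mul (2 * π * M))).hasDerivWithinAt) fun τ hτ => ?_
    have hτ : 1 < τ := by simpa using hτ
    have h := mul_le_mul_of_nonneg_left (hM τ hτ.le x) (by positivity : 0 ≤ 4 * π * τ)
    push_cast
    linarith
  have h1 := hanti self_mem_Ici ht ht
  have h2 := hmono self_mem_Ici ht ht
  simp only [one_mul, mul_one, one_pow] at h1 h2
  exact ⟨h1, h2⟩

/-- On a compact time interval `η` is bounded above. -/
lemma exists_exp_neg_two_eta_ge {T : ℝ} (hT : 1 ≤ T) :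
    ∃ c, 0 < c ∧ ∀ t ∈ Icc 1 T, ∀ x, c ≤ exp (-2 * sol.η t x) := by
  obtain ⟨t₀, -, x₀, h⟩ := exists_forall_le_of_periodic hT sol.η_c1.continuousOn sol.η_per
  refine ⟨exp (-2 * sol.η t₀ x₀), exp_pos _, fun t ht x => exp_le_exp.2 ?_⟩
  linarith [h t ht x]

/-- The metric coefficient `e^{-2η}` is bounded below by a positive multiple of `t²`. -/
lemma exists_sq_mul_le_exp_neg_two_eta (hΛ : 0 < Λ) {M : ℝ} (hM0 : 0 ≤ M)
    (hM : ∀ t, 1 ≤ t → ∀ x, t * (sol.r t x + sol.s t x) ≤ M) :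
    ∃ c, 0 < c ∧ ∀ t, 1 ≤ t → ∀ x, c * t ^ 2 ≤ exp (-2 * sol.η t x) := by
  set B := Λ / 3 + 2 * π * M with hB
  have hB0 : 0 < B := by positivity
  set T := 1 + 6 * B / Λ with hTdef
  have hT : 1 ≤ T := by
    have : 0 ≤ 6 * B / Λ := by positivity
    linarith
  obtain ⟨c, hc, hcb⟩ := sol.exists_exp_neg_two_eta_ge hT
  have hT0 : 0 < T := by linarith
  refine ⟨min (c / T ^ 2) (Λ / 6), by positivity, fun t ht x => ?_⟩
  rcases le_total t T with htT | htT
  · calc min (c / T ^ 2) (Λ / 6) * t ^ 2 ≤ c / T ^ 2 * T ^ 2 := by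
          gcongr
          exact min_le_left _ _
      _ = c := by field_simp
      _ ≤ _ := hcb t ⟨ht, htT⟩ x
  · refine (mul_le_mul_of_nonneg_right (min_le_right _ _) (sq_nonneg t)).trans ?_
    have ht0 : 0 < t := by linarith
    refine le_of_mul_le_mul_left ?_ ht0
    have h2 := (sol.exp_neg_two_eta_bounds hM ht x).2
    have hp := exp_pos (-2 * sol.η 1 x)
    have hΛt : 6 * B ≤ Λ * t := by
      have : Λ * T = Λ + 6 * B := by rw [hTdef]; field_simp
      nlinarith [mul_le_mul_of_nonneg_left htT hΛ.le]
    have h3 := mul_le_mul_of_nonneg_right hΛt (sq_nonneg t)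
    have hπ : 0 ≤ 2 * π * M := by positivity
    have h4 : Λ / 3 ≤ Λ / 3 * t ^ 2 := le_mul_of_one_le_right (by positivity) (one_le_pow₀ ht)
    rw [hB] at h3
    linarith

end RegularSolution

/-- Late-time asymptotics of `∂ₜη` (Theorem 4.1). -/
theorem eta_t_asymptotics (Λ : ℝ) (hΛ : 0 < Λ)
    (sol : RegularSolution Λ (Set.Ici 1)) :
    ∃ C : ℝ, 0 < C ∧ ∀ t : ℝ, 1 ≤ t → ∀ x : ℝ,
      |pderivT sol.η t x + 1 / t| ≤ C / t ^ 2 := by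
  obtain ⟨M, hM0, hM⟩ := sol.exists_matter_bound hΛ
  obtain ⟨c, hc, hcb⟩ := sol.exists_sq_mul_le_exp_neg_two_eta hΛ hM0 hM
  obtain ⟨t₁, -, x₁, hK⟩ := exists_forall_le_of_periodic
    (f := fun t x => exp (-2 * sol.η t x)) le_rfl
    ((sol.η_c1.continuousOn.const_mul (-2)).rexp) (fun t ht x => by simp only [sol.η_per t ht x])
  set K := exp (-2 * sol.η t₁ x₁) with hKdef
  have hK0 : 0 < K := exp_pos _
  have hπ : 0 ≤ π * M := by positivity
  set A := Λ + 3 * K + 6 * (π * M) with hA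
  have hA0 : 0 < A := by positivity
  refine ⟨A / (2 * c), by positivity, fun t ht x => ?_⟩
  have ht0 : 0 < t := by linarith
  have hu := hcb t ht x
  obtain ⟨hup, hlow⟩ := sol.exp_neg_two_eta_bounds hM ht x
  have hK1 : exp (-2 * sol.η 1 x) ≤ K := hK 1 ⟨le_rfl, le_rfl⟩ x
  have hp := exp_pos (-2 * sol.η 1 x)
  have hE2 := sol.eqE2 t ht x
  have hmat := mul_le_mul_of_nonneg_left (hM t ht x) (by positivity : 0 ≤ 4 * π * t ^ 2)
  have hmat0 : 0 ≤ 4 * π * t ^ 2 * (t * (sol.r t x + sol.s t x)) := by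
    have := sol.r_nonneg t ht x
    have := sol.s_nonneg t ht x
    positivity
  set u := exp (-2 * sol.η t x) with hudef
  set D := pderivT sol.η t x + 1 / t with hD
  have hDt : t * D = t * pderivT sol.η t x + 1 := by rw [hD]; field_simp
  have hid : 2 * t ^ 2 * u * D = 3 * (t * u - Λ * t ^ 3 / 3)
      + 4 * π * t ^ 2 * (t * (sol.r t x + sol.s t x)) := by
    linear_combination 2 * t * u * hDt + t * hE2
  have ht2 : 1 ≤ t ^ 2 := one_le_pow₀ ht
  have hΛ2 : Λ ≤ Λ * t ^ 2 := le_mul_of_one_le_right hΛ.le ht2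
  have hK2 : K ≤ K * t ^ 2 := le_mul_of_one_le_right hK0.le ht2
  have hM2 : 0 ≤ π * M * t ^ 2 := by positivity
  have habs : |2 * t ^ 2 * u * D| ≤ A * t ^ 2 := by
    rw [hid, abs_le, hA]
    constructor <;> linarith
  rw [abs_mul, abs_of_pos (by positivity : 0 < 2 * t ^ 2 * u)] at habs
  rw [le_div_iff₀ (by positivity), le_div_iff₀ (by positivity)]
  refine le_of_mul_le_mul_right ?_ (by positivity : 0 < t ^ 2)
  calc |D| * t ^ 2 * (2 * c) * t ^ 2 = 2 * t ^ 2 * (c * t ^ 2) * |D| := by ring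
    _ ≤ 2 * t ^ 2 * u * |D| := by gcongr
    _ ≤ A * t ^ 2 := habs
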